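/- Let 0 < m < Q and set s(t) = √(t² − m²) for t ≥ m. Then for every ξ ∈ (m,Q), ∫_m^Q [ log((y+ξ)/|y−ξ|) + log( (s(ξ)s(y) + ξy − m²) / (s(ξ)s(y) + ξy + m²) ) ] · ( y / (π √(Q² − y²)) ) dy = s(ξ) (the improper integral converges). -/

import Mathlib

open MeasureTheory

/-- A primitive in `b` of `log ((b + a) / |b - a|) * (b / √(q ^ 2 - b ^ 2))`. -/
noncomputable def logKernelPrimitive (a q b : ℝ) : ℝ :=
  (√(q ^ 2 - b ^ 2) - √(q ^ 2 - a ^ 2)) * Real.log (b - a)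
    - (√(q ^ 2 - b ^ 2) + √(q ^ 2 - a ^ 2)) * Real.log (b + a)
    + 2 * √(q ^ 2 - a ^ 2) * Real.log (√(q ^ 2 - a ^ 2) * b + a * √(q ^ 2 - b ^ 2))
    + 2 * a * Real.arcsin (b / q)

lemma hasDerivAt_sqrt_sq_sub_sq {q b : ℝ} (h : b ^ 2 < q ^ 2) :
    HasDerivAt (fun x => √(q ^ 2 - x ^ 2)) (-b / √(q ^ 2 - b ^ 2)) b := by
  have h0 : q ^ 2 - b ^ 2 ≠ 0 := by linarith
  have h1 : HasDerivAt (fun x : ℝ => q ^ 2 - x ^ 2) (-(2 * b)) b := by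
    simpa using (hasDerivAt_pow 2 b).const_sub (q ^ 2)
  convert h1.sqrt h0 using 1
  have : √(q ^ 2 - b ^ 2) ≠ 0 := (Real.sqrt_pos.2 (by linarith)).ne'
  field_simp

lemma hasDerivAt_logKernelPrimitive {a q b : ℝ} (ha : 0 < a) (haq : a < q) (hb : 0 < b)
    (hbq : b < q) (hba : b ≠ a) :
    HasDerivAt (logKernelPrimitive a q)
      (Real.log ((b + a) / |b - a|) * (b / √(q ^ 2 - b ^ 2))) b := by
  have hq : 0 < q := ha.trans haq
  have hr2 : 0 < q ^ 2 - b ^ 2 := by nlinarith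
  have hc2 : 0 < q ^ 2 - a ^ 2 := by nlinarith
  have hr' := hasDerivAt_sqrt_sq_sub_sq (q := q) (b := b) (by linarith)
  have hr := Real.sqrt_pos.2 hr2
  have hc := Real.sqrt_pos.2 hc2
  have hrs := Real.sq_sqrt hr2.le
  have hcs := Real.sq_sqrt hc2.le
  have hsub : b - a ≠ 0 := sub_ne_zero.2 hba
  have hpos : 0 < √(q ^ 2 - a ^ 2) * b + a * √(q ^ 2 - b ^ 2) := by positivity
  have hasin : HasDerivAt (fun x : ℝ => Real.arcsin (x / q)) (1 / √(q ^ 2 - b ^ 2)) b := by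
    have hlt : b / q < 1 := (div_lt_one hq).2 hbq
    have hgt : 0 < b / q := by positivity
    have h := (Real.hasDerivAt_arcsin (x := b / q) (by linarith) hlt.ne).comp b
      ((hasDerivAt_id b).div_const q)
    refine h.congr_deriv ?_
    have : 1 - (b / q) ^ 2 = (q ^ 2 - b ^ 2) / q ^ 2 := by field_simp
    rw [this, Real.sqrt_div hr2.le, Real.sqrt_sq hq.le]
    field_simp
  have key := ((((hr'.sub_const √(q ^ 2 - a ^ 2)).mul
      (((hasDerivAt_id b).sub_const a).log hsub)).sub
    ((hr'.add_const √(q ^ 2 - a ^ 2)).mul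
      (((hasDerivAt_id b).add_const a).log (add_pos hb ha).ne'))).add
    (((((hasDerivAt_id b).const_mul √(q ^ 2 - a ^ 2)).add (hr'.const_mul a)).log
      hpos.ne').const_mul (2 * √(q ^ 2 - a ^ 2)))).add (hasin.const_mul (2 * a))
  refine key.congr_deriv ?_
  rw [Real.log_div (add_pos hb ha).ne' (abs_ne_zero.2 hsub), Real.log_abs]
  simp only [id, Pi.add_apply]
  generalize √(q ^ 2 - b ^ 2) = r at *
  generalize √(q ^ 2 - a ^ 2) = c at *
  have hab : b + a ≠ 0 := (add_pos hb ha).ne'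
  have hne := hpos.ne'
  have hrat : (r - c) / (b - a) - (r + c) / (b + a)
      + 2 * c * ((c - a * b / r) / (c * b + a * r)) + 2 * a / r = 0 := by
    have hrel : r ^ 2 + b ^ 2 - c ^ 2 - a ^ 2 = 0 := by linarith
    have hr0 := hr.ne'
    field_simp
    linear_combination 2 * a ^ 2 * r * hrel
  linear_combination hrat

lemma continuousOn_logKernelPrimitive {a q : ℝ} (ha : 0 < a) (haq : a < q) :
    ContinuousOn (logKernelPrimitive a q) (Set.Icc 0 q) := by
  have hc : 0 < √(q ^ 2 - a ^ 2) := Real.sqrt_pos.2 (by nlinarith)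
  have hroot : Continuous (fun b : ℝ => √(q ^ 2 - b ^ 2)) := by fun_prop
  have hfirst : ContinuousOn (fun b : ℝ =>
      (√(q ^ 2 - b ^ 2) - √(q ^ 2 - a ^ 2)) * Real.log (b - a)) (Set.Icc 0 q) := by
    have h : Continuous (fun b : ℝ => -((b - a) * Real.log (b - a)) * (b + a) /
        (√(q ^ 2 - b ^ 2) + √(q ^ 2 - a ^ 2))) := by
      refine Continuous.div ?_ (hroot.add continuous_const) fun b => by positivity
      exact ((Real.continuous_mul_log.comp (continuous_id.sub continuous_const)).neg).mul
        (by fun_prop)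
    refine h.continuousOn.congr fun b hb => ?_
    have hrs := Real.sq_sqrt (show 0 ≤ q ^ 2 - b ^ 2 by nlinarith [hb.1, hb.2])
    have hcs := Real.sq_sqrt (show 0 ≤ q ^ 2 - a ^ 2 by nlinarith)
    have hne : √(q ^ 2 - b ^ 2) + √(q ^ 2 - a ^ 2) ≠ 0 := by positivity
    simp only
    rw [eq_div_iff hne]
    linear_combination Real.log (b - a) * (hrs - hcs)
  refine ((hfirst.sub ?_).add ?_).add ?_
  · exact (hroot.add continuous_const).continuousOn.mul
      (ContinuousOn.log (by fun_prop) fun b hb => by linarith [hb.1])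
  · refine continuousOn_const.mul (ContinuousOn.log (by fun_prop) fun b hb => ?_)
    rcases hb.1.eq_or_lt with rfl | h
    · have : 0 < √(q ^ 2 - 0 ^ 2) := Real.sqrt_pos.2 (by nlinarith)
      positivity
    · positivity
  · exact continuousOn_const.mul
      (Real.continuous_arcsin.comp (continuous_id.div_const q)).continuousOn

lemma logKernelPrimitive_sub {a q : ℝ} (ha : 0 < a) (haq : a < q) :
    logKernelPrimitive a q q - logKernelPrimitive a q 0 = Real.pi * a := by
  have hq : 0 < q := ha.trans haq
  have hc2 : 0 < q ^ 2 - a ^ 2 := by nlinarith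
  have hc := Real.sqrt_pos.2 hc2
  have hlog : Real.log (q - a) + Real.log (q + a) = 2 * Real.log √(q ^ 2 - a ^ 2) := by
    rw [← Real.log_mul (by linarith) (by linarith), Real.log_sqrt hc2.le]
    ring_nf
  simp only [logKernelPrimitive, sub_self, Real.sqrt_zero, div_self hq.ne', Real.arcsin_one,
    zero_div, Real.arcsin_zero, mul_zero, zero_sub, zero_add, add_zero, Real.log_neg_eq_log,
    ne_eq, OfNat.ofNat_ne_zero, not_false_eq_true, zero_pow, sub_zero, Real.sqrt_sq hq.le]
  rw [Real.log_mul hc.ne' hq.ne', Real.log_mul ha.ne' hq.ne']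
  linear_combination -√(q ^ 2 - a ^ 2) * hlog

/-- The breather kernel in `y, ξ` is the soliton kernel in `b = √(y² - m²)`, `a = √(ξ² - m²)`. -/
lemma log_breather_kernel {m ξ y a b : ℝ} (hm : 0 < m) (hξ : m < ξ) (hy : m < y)
    (ha : 0 < a) (hb : 0 < b) (ha2 : a ^ 2 = ξ ^ 2 - m ^ 2) (hb2 : b ^ 2 = y ^ 2 - m ^ 2)
    (hyξ : y ≠ ξ) :
    Real.log ((y + ξ) / |y - ξ|)
        + Real.log ((a * b + ξ * y - m ^ 2) / (a * b + ξ * y + m ^ 2))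
      = Real.log ((b + a) / |b - a|) := by
  have hyx : 0 < |y - ξ| := abs_pos.2 (sub_ne_zero.2 hyξ)
  have hprod : (y + ξ) * (y - ξ) = (b + a) * (b - a) := by linear_combination ha2 - hb2
  have hsum : 0 < y + ξ := by linarith
  have hsum' : 0 < b + a := by linarith
  have habs : (y + ξ) * |y - ξ| = (b + a) * |b - a| := by
    rw [← abs_of_pos hsum, ← abs_mul, hprod, abs_mul, abs_of_pos hsum']
  have hba : 0 < |b - a| := by
    refine (abs_nonneg _).lt_of_ne fun h => ?_
    rw [← h, mul_zero] at habs
    exact (mul_pos hsum hyx).ne' habs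
  have hab : 0 < a * b := mul_pos ha hb
  have hnum : 0 < a * b + ξ * y - m ^ 2 := by nlinarith
  have hden : 0 < a * b + ξ * y + m ^ 2 := by nlinarith
  rw [← Real.log_mul (by positivity) (by positivity)]
  congr 1
  have hpoly : (y + ξ) ^ 2 * (a * b + ξ * y - m ^ 2)
      = (b + a) ^ 2 * (a * b + ξ * y + m ^ 2) := by
    have hξ2 : ξ ^ 2 = a ^ 2 + m ^ 2 := by linarith
    have hy2 : y ^ 2 = b ^ 2 + m ^ 2 := by linarith
    have hq : (ξ * y) ^ 2 = (a ^ 2 + m ^ 2) * (b ^ 2 + m ^ 2) := by rw [mul_pow, hξ2, hy2]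
    linear_combination 2 * hq + (a * b + ξ * y - m ^ 2) * (hξ2 + hy2)
  rw [div_mul_div_comm, div_eq_div_iff (by positivity) (by positivity)]
  refine mul_left_cancel₀ hsum.ne' ?_
  linear_combination |b - a| * hpoly - (b + a) * (a * b + ξ * y + m ^ 2) * habs

lemma log_add_div_abs_sub_nonneg {a b : ℝ} (ha : 0 < a) (hb : 0 < b) :
    0 ≤ Real.log ((b + a) / |b - a|) := by
  rcases eq_or_ne b a with rfl | h
  · simp
  · refine Real.log_nonneg ((one_le_div (abs_pos.2 (sub_ne_zero.2 h))).2 ?_)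
    exact abs_le.2 ⟨by linarith, by linarith⟩

/-- The same density of states `u(y) = y/(π√(Q²−y²))`, restricted to `[im,iQ]`, also
solves the breather-gas dispersion relation with `σ ≡ 0` and permanent band `[−im,im]`,
in real variables. -/
theorem stmt_5 (m Q : ℝ) (hm : 0 < m) (hmQ : m < Q)
    (s : ℝ → ℝ) (hs : ∀ t, m ≤ t → s t = Real.sqrt (t ^ 2 - m ^ 2)) :
    ∀ ξ ∈ Set.Ioo m Q,
      IntervalIntegrable
        (fun y => (Real.log ((y + ξ) / |y - ξ|)
            + Real.log ((s ξ * s y + ξ * y - m ^ 2) / (s ξ * s y + ξ * y + m ^ 2)))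
          * (y / (Real.pi * Real.sqrt (Q ^ 2 - y ^ 2))))
        volume m Q ∧
      ∫ y in m..Q,
        (Real.log ((y + ξ) / |y - ξ|)
            + Real.log ((s ξ * s y + ξ * y - m ^ 2) / (s ξ * s y + ξ * y + m ^ 2)))
          * (y / (Real.pi * Real.sqrt (Q ^ 2 - y ^ 2))) = s ξ := by
  rintro ξ ⟨hmξ, hξQ⟩
  set f : ℝ → ℝ := fun y => (Real.log ((y + ξ) / |y - ξ|)
            + Real.log ((s ξ * s y + ξ * y - m ^ 2) / (s ξ * s y + ξ * y + m ^ 2)))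
          * (y / (Real.pi * Real.sqrt (Q ^ 2 - y ^ 2))) with hf
  set q := √(Q ^ 2 - m ^ 2) with hq
  set a := s ξ with ha_def
  have ha_eq : a = √(ξ ^ 2 - m ^ 2) := hs ξ hmξ.le
  have hpos : ∀ {y}, m < y → 0 < √(y ^ 2 - m ^ 2) := fun h => Real.sqrt_pos.2 (by nlinarith)
  have hsq : ∀ {y}, m < y → √(y ^ 2 - m ^ 2) ^ 2 = y ^ 2 - m ^ 2 := fun h =>
    Real.sq_sqrt (by nlinarith)
  have hlt : ∀ {x y}, m < x → x < y → √(x ^ 2 - m ^ 2) < √(y ^ 2 - m ^ 2) := fun h h' =>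
    Real.sqrt_lt_sqrt (by nlinarith) (by nlinarith)
  have ha : 0 < a := ha_eq ▸ hpos hmξ
  have haq : a < q := ha_eq ▸ hlt hmξ hξQ
  set F : ℝ → ℝ := fun y => logKernelPrimitive a q √(y ^ 2 - m ^ 2) / Real.pi with hF
  have hker : ∀ y ∈ Set.Ioo m Q, y ≠ ξ → f y =
      Real.log ((√(y ^ 2 - m ^ 2) + a) / |√(y ^ 2 - m ^ 2) - a|)
        * (y / (Real.pi * √(Q ^ 2 - y ^ 2))) := fun y hy hyξ => by
    simp only [hf, hs y hy.1.le]
    rw [log_breather_kernel hm hmξ hy.1 ha (hpos hy.1) (ha_eq ▸ hsq hmξ) (hsq hy.1) hyξ]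
  have hcont : ContinuousOn F (Set.Icc m Q) := by
    refine ((continuousOn_logKernelPrimitive ha haq).comp (by fun_prop) ?_).div_const _
    exact fun y hy => ⟨Real.sqrt_nonneg _, Real.sqrt_le_sqrt (by nlinarith [hy.1, hy.2])⟩
  have hderiv : ∀ y ∈ Set.Ioo m Q, y ≠ ξ → HasDerivAt F (f y) y := fun y hy hyξ => by
    have hb := hpos hy.1
    have hba : √(y ^ 2 - m ^ 2) ≠ a := by
      rw [ha_eq]
      rcases hyξ.lt_or_gt with h | h
      exacts [(hlt hy.1 h).ne, (hlt hmξ h).ne']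
    have hd : HasDerivAt (fun x : ℝ => √(x ^ 2 - m ^ 2)) (y / √(y ^ 2 - m ^ 2)) y := by
      have h := ((hasDerivAt_pow 2 y).sub_const (m ^ 2)).sqrt (by nlinarith [hy.1])
      convert h using 1
      norm_num
      field_simp
    refine (((hasDerivAt_logKernelPrimitive ha haq hb (hlt hy.1 hy.2) hba).comp y hd).div_const
      Real.pi).congr_deriv ?_
    have hqb : q ^ 2 - √(y ^ 2 - m ^ 2) ^ 2 = Q ^ 2 - y ^ 2 := by
      rw [hq, hsq hmQ, hsq hy.1]; ring
    have hr : 0 < √(Q ^ 2 - y ^ 2) := Real.sqrt_pos.2 (by nlinarith [hy.1, hy.2])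
    rw [hker y hy hyξ, hqb]
    field_simp
  have hnonneg : ∀ y ∈ Set.Ioo m Q, y ≠ ξ → 0 ≤ f y := fun y hy hyξ => by
    rw [hker y hy hyξ]
    have : 0 < y := hm.trans hy.1
    exact mul_nonneg (log_add_div_abs_sub_nonneg ha (hpos hy.1)) (by positivity)
  have hpiece : ∀ u v, m ≤ u → u ≤ v → v ≤ Q → ξ ∉ Set.Ioo u v →
      IntervalIntegrable f volume u v ∧ ∫ y in u..v, f y = F v - F u := by
    intro u v hu huv hv hξ
    have hmem : ∀ y ∈ Set.Ioo u v, y ∈ Set.Ioo m Q ∧ y ≠ ξ := fun y hy =>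
      ⟨⟨hu.trans_lt hy.1, hy.2.trans_le hv⟩, fun h => hξ (h ▸ hy)⟩
    have hc := hcont.mono (Set.Icc_subset_Icc hu hv)
    have hd : ∀ y ∈ Set.Ioo u v, HasDerivAt F (f y) y := fun y hy =>
      hderiv y (hmem y hy).1 (hmem y hy).2
    have hi : IntervalIntegrable f volume u v := by
      rw [intervalIntegrable_iff_integrableOn_Ioc_of_le huv]
      exact intervalIntegral.integrableOn_deriv_of_nonneg hc hd fun y hy =>
        hnonneg y (hmem y hy).1 (hmem y hy).2
    exact ⟨hi, intervalIntegral.integral_eq_sub_of_hasDerivAt_of_le huv hc hd hi⟩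
  obtain ⟨hi₁, he₁⟩ := hpiece m ξ le_rfl hmξ.le hξQ.le fun h => h.2.false
  obtain ⟨hi₂, he₂⟩ := hpiece ξ Q hmξ.le hξQ.le le_rfl fun h => h.1.false
  refine ⟨hi₁.trans hi₂, ?_⟩
  rw [← intervalIntegral.integral_add_adjacent_intervals hi₁ hi₂, he₁, he₂]
  have hend : F Q - F m = a := by
    simp only [hF, sub_self, Real.sqrt_zero, ← hq]
    rw [← sub_div, logKernelPrimitive_sub ha haq, mul_div_cancel_left₀ _ Real.pi_ne_zero]
  linarith
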